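/- arXiv:2306.09787 — 2 statements merged into one kernel-verified Lean document; each statement's English description precedes it below -/
import Mathlib

section
/- Let A ≥ 1 and s be real, let c ≥ 0, let δ ∈ (0,1), and let ν be a probability measure on [0,1] with mean p = ∫₀¹ u dν(u) > 0. Define φ = ∫₀¹ 1/(1 + Au) dν(u). Then ((A+1)/2)(1 - φ) + exp(s + c·φ·(1-φ)^{δ-1}) ≤ A/2 + exp(s + c·(p/2)^{δ-1}). -/
open MeasureTheory

/-- Aggressive-updating (η = 1) bound on the network average AoI: with age threshold
`A ≥ 1`, noise term `s`, spatial-contention constant `c ≥ 0`, `δ ∈ (0,1)`, and `ν` the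
distribution of the conditional transmission success probability with mean `p > 0`,
letting `φ = ∫₀¹ 1/(1 + Au) dν(u)`,
`((A+1)/2)(1-φ) + exp(s + cφ(1-φ)^{δ-1}) ≤ A/2 + exp(s + c(p/2)^{δ-1})`. -/
theorem stmt_12 (ν : Measure ℝ) [IsProbabilityMeasure ν]
    (hsupp : ∀ᵐ u ∂ν, u ∈ Set.Icc (0 : ℝ) 1)
    (A s c δ : ℝ) (hA : 1 ≤ A) (hc : 0 ≤ c) (hδ₀ : 0 < δ) (hδ₁ : δ < 1)
    (p : ℝ) (hp : p = ∫ u, u ∂ν) (hp₀ : 0 < p)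
    (φ : ℝ) (hφ : φ = ∫ u, 1 / (1 + A * u) ∂ν) :
    (A + 1) / 2 * (1 - φ) + Real.exp (s + c * φ * (1 - φ) ^ (δ - 1)) ≤
      A / 2 + Real.exp (s + c * (p / 2) ^ (δ - 1)) := by
  have h_meas : AEStronglyMeasurable (fun u : ℝ => 1 / (1 + A * u)) ν :=
    (by fun_prop : Measurable fun u : ℝ => 1 / (1 + A * u)).aestronglyMeasurable
  have h_intU : Integrable (fun u : ℝ => u) ν := by
    refine Integrable.of_bound measurable_id.aestronglyMeasurable 1 ?_
    filter_upwards [hsupp] with u hu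
    rw [Real.norm_of_nonneg hu.1]
    exact hu.2
  have h_int : Integrable (fun u : ℝ => 1 / (1 + A * u)) ν := by
    refine Integrable.of_bound h_meas 1 ?_
    filter_upwards [hsupp] with u hu
    have hAu : 0 ≤ A * u := mul_nonneg (by linarith) hu.1
    rw [Real.norm_of_nonneg (by positivity), div_le_one (by positivity)]
    linarith
  have h_lower : 1 / (1 + A) ≤ φ := by
    have h : ∫ _, 1 / (1 + A) ∂ν ≤ ∫ u, 1 / (1 + A * u) ∂ν := by
      refine integral_mono_ae (integrable_const _) h_int ?_
      filter_upwards [hsupp] with u hu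
      have hAu : 0 ≤ A * u := mul_nonneg (by linarith) hu.1
      exact one_div_le_one_div_of_le (by positivity) (by nlinarith [hu.2])
    simpa [hφ] using h
  have h_upper : φ ≤ 1 - p / 2 := by
    have h : ∫ u, 1 / (1 + A * u) ∂ν ≤ ∫ u, (1 - u / 2) ∂ν := by
      refine integral_mono_ae h_int ((integrable_const _).sub (h_intU.div_const 2)) ?_
      filter_upwards [hsupp] with u hu
      have hAu : u ≤ A * u := le_mul_of_one_le_left hu.1 hA
      have hu₀ := hu.1
      have hu₁ := hu.2
      change 1 / (1 + A * u) ≤ 1 - u / 2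
      rw [div_le_iff₀ (by linarith)]
      nlinarith [mul_nonneg hu₀ (sub_nonneg.2 hu₁)]
    rw [integral_sub (integrable_const _) (h_intU.div_const 2), integral_div] at h
    simpa [hφ, hp] using h
  have h_age : (A + 1) / 2 * (1 - φ) ≤ A / 2 := by
    rw [div_le_iff₀ (by linarith)] at h_lower
    linarith
  have h_pow : (1 - φ) ^ (δ - 1) ≤ (p / 2) ^ (δ - 1) :=
    Real.rpow_le_rpow_of_nonpos (by linarith) (by linarith) (by linarith)
  have h_pow_nonneg : 0 ≤ (1 - φ) ^ (δ - 1) := Real.rpow_nonneg (by linarith) _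
  have h_exponent : c * φ * (1 - φ) ^ (δ - 1) ≤ c * (p / 2) ^ (δ - 1) := by
    rw [mul_assoc]
    exact mul_le_mul_of_nonneg_left
      ((mul_le_of_le_one_left h_pow_nonneg (by linarith)).trans h_pow) hc
  exact add_le_add h_age (Real.exp_le_exp.2 (by linarith))
end

section
/- Let η, μ ∈ (0,1]. Then the function f : [0,∞) → ℝ defined by f(A) = (A+1)/2 + ((A-1)/2 + 1/(ημ)) / (1 + Aημ) is strictly increasing on [0,∞). -/
/-- In the sparse-deployment regime the average AoI
`f(A) = (A+1)/2 + ((A-1)/2 + 1/(ημ))/(1 + Aημ)` is strictly increasing in the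
age threshold `A` on `[0, ∞)`. -/
theorem stmt_13 (η μ : ℝ) (hη₀ : 0 < η) (hη₁ : η ≤ 1) (hμ₀ : 0 < μ) (hμ₁ : μ ≤ 1) :
    StrictMonoOn
      (fun A : ℝ => (A + 1) / 2 + ((A - 1) / 2 + 1 / (η * μ)) / (1 + A * η * μ))
      (Set.Ici (0 : ℝ)) := by
  intro x hx y hy hxy
  have hx₀ : 0 ≤ x := hx
  have hy₀ : 0 ≤ y := hy
  have hp : 0 < η * μ := mul_pos hη₀ hμ₀
  have hu : 0 < 1 + x * η * μ := by positivity
  have hv : 0 < 1 + y * η * μ := by positivity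
  have key : ((y + 1) / 2 + ((y - 1) / 2 + 1 / (η * μ)) / (1 + y * η * μ)) -
      ((x + 1) / 2 + ((x - 1) / 2 + 1 / (η * μ)) / (1 + x * η * μ)) =
      (y - x) * (η * μ + x * η * μ + y * η * μ + (x * η * μ) * (y * η * μ)) /
        (2 * (1 + x * η * μ) * (1 + y * η * μ)) := by
    field_simp
    ring
  have hpos : 0 < (y - x) * (η * μ + x * η * μ + y * η * μ + (x * η * μ) * (y * η * μ)) /
      (2 * (1 + x * η * μ) * (1 + y * η * μ)) := by
    have := sub_pos.mpr hxy
    positivity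
  exact sub_pos.mp (key ▸ hpos)
end
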